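/- There is no Gallai coloring of K_9 with exactly 5 colors whose color class sizes are 12, 6, 6, 6, 6. -/

import Mathlib

/-- A Gallai coloring of `K_n`: an edge coloring with no triangle receiving
three pairwise distinct colors. -/
def IsGallaiColoring {n : ℕ} {C : Type*} (c : Sym2 (Fin n) → C) : Prop :=
  ∀ x y z : Fin n, x ≠ y → y ≠ z → x ≠ z →
    c s(x, y) = c s(y, z) ∨ c s(y, z) = c s(x, z) ∨ c s(x, y) = c s(x, z)

/-- Two-coloured cut of a vertex set. -/
def HasCut {V C : Type*} (c : V → V → C) (S : Finset V) : Prop :=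
  ∃ a b : C, ∃ P : V → Prop, (∃ x ∈ S, P x) ∧ (∃ y ∈ S, ¬ P y) ∧
    ∀ x ∈ S, ∀ y ∈ S, P x → ¬ P y → (c x y = a ∨ c x y = b)

/-- Homogeneous partition with at most two colours across parts. -/
def HasPart {V C : Type*} (c : V → V → C) (S : Finset V) : Prop :=
  ∃ a b : C, ∃ r : Setoid V, (∃ x ∈ S, ∃ y ∈ S, ¬ r x y) ∧
    (∀ x ∈ S, ∀ y ∈ S, ¬ r x y → (c x y = a ∨ c x y = b)) ∧
    (∀ x y z, z ∈ S → r x y → ¬ r x z → c x z = c y z)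

/-- Gallai condition for a symmetric function of two vertices. -/
def Gal {V C : Type*} (c : V → V → C) : Prop :=
  ∀ x y z : V, x ≠ y → y ≠ z → x ≠ z →
    c x y = c y z ∨ c y z = c x z ∨ c x y = c x z

theorem HasCut.part {V C : Type*} {c : V → V → C} {S : Finset V}
    (hs : ∀ x y, c x y = c y x) (hG : Gal c) (h : HasCut c S) : HasPart c S := by
  obtain ⟨a, b, P, ⟨x, hx, hPx⟩, ⟨y, hy, hPy⟩, hc⟩ := h
  let R : V → V → Prop := fun x y => x ∈ S ∧ y ∈ S ∧ x ≠ y ∧ c x y ≠ a ∧ c x y ≠ b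
  have hcross : ∀ x ∈ S, ∀ y ∈ S, ¬ (Relation.EqvGen.setoid R) x y →
      (c x y = a ∨ c x y = b) := by
    intro x hx y hy hr
    by_contra hn
    push Not at hn
    apply hr
    by_cases hxy : x = y
    · subst hxy; exact Relation.EqvGen.refl _
    · exact Relation.EqvGen.rel _ _ ⟨hx, hy, hxy, hn.1, hn.2⟩
  refine ⟨a, b, Relation.EqvGen.setoid R, ⟨x, hx, y, hy, ?_⟩, hcross, ?_⟩
  · intro hr
    have key : ∀ u v, Relation.EqvGen R u v → (P u ↔ P v) := by
      intro u v huv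
      induction huv with
      | rel u v h =>
        obtain ⟨h1, h2, h3, h4, h5⟩ := h
        have := hc u h1 v h2
        have := hc v h2 u h1
        have := hs u v
        grind
      | refl => rfl
      | symm _ _ _ ih => exact ih.symm
      | trans _ _ _ _ _ ih1 ih2 => exact ih1.trans ih2
    exact hPy ((key x y hr).1 hPx)
  · intro u v z hz huv
    have huv' : Relation.EqvGen R u v := huv
    clear huv
    induction huv' with
    | rel u v h =>
      intro hn
      have h' := h
      obtain ⟨h1, h2, h3, h4, h5⟩ := h
      have hn2 : ¬ (Relation.EqvGen.setoid R) v z := fun hh =>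
        hn (Relation.EqvGen.trans _ _ _ (Relation.EqvGen.rel _ _ h') hh)
      have e1 := hcross u h1 z hz hn
      have e2 := hcross v h2 z hz hn2
      have n1 : u ≠ z := fun e => hn (e ▸ Relation.EqvGen.refl _)
      have n2 : v ≠ z := fun e => hn2 (e ▸ Relation.EqvGen.refl _)
      have := hG u v z h3 n2 n1
      grind
    | refl => intro _; rfl
    | symm u v h ih =>
      intro hn
      exact (ih (fun hh => hn (Relation.EqvGen.trans _ _ _ (Relation.EqvGen.symm _ _ h) hh))).symm
    | trans u v w h1 h2 ih1 ih2 =>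
      intro hn
      exact (ih1 hn).trans
        (ih2 (fun hh => hn (Relation.EqvGen.trans _ _ _ h1 hh)))

theorem hasCut {V C : Type*} [DecidableEq V] {c : V → V → C}
    (hs : ∀ x y, c x y = c y x) (hG : Gal c) (S : Finset V) (h2 : 2 ≤ S.card) :
    HasCut c S := by
  induction S using Finset.induction_on with
  | empty => simp at h2
  | insert v T hv ih =>
    rw [Finset.card_insert_of_notMem hv] at h2
    by_cases hT : T.card = 1
    · obtain ⟨t, rfl⟩ := Finset.card_eq_one.1 hT
      refine ⟨c v t, c v t, fun x => x = v, ⟨v, by simp⟩, ⟨t, by simp, ?_⟩, ?_⟩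
      · intro e; simp [e] at hv
      · intro x hx y hy h1 h2
        simp at hx hy
        grind
    obtain ⟨a, b, r, ⟨x0, hx0, y0, hy0, hxy⟩, hc, hh⟩ := (ih (by omega)).part hs hG
    have hne : ∀ x ∈ T, v ≠ x := by rintro x hx rfl; exact hv hx
    have hrne : ∀ x y, ¬ r x y → x ≠ y := by rintro x y h rfl; exact h (r.refl _)
    have rs : ∀ x y, r x y → r y x := fun x y h => r.symm h
    have rt : ∀ x y z, r x y → r y z → r x z := fun x y z h h' => r.trans h h'
    by_cases hall : ∀ t ∈ T, ∃ x ∈ T, r t x ∧ c v x ≠ a ∧ c v x ≠ b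
    · obtain ⟨dx, hdx, rdx, dxa, dxb⟩ := hall x0 hx0
      obtain ⟨dy, hdy, rdy, dya, dyb⟩ := hall y0 hy0
      have hD : ∀ x ∈ T, ∀ y ∈ T, ¬ r x y → c v x ≠ a → c v x ≠ b → c v y ≠ a → c v y ≠ b →
          c v x = c v y := by
        intro x hx y hy hr h1 h2 h3 h4
        have := hG v x y (hne x hx) (hrne _ _ hr) (hne y hy)
        have := hc x hx y hy hr
        grind
      -- if c v z ∈ {a,b}, then z sees D-vertices of other classes in that colour
      have hZ : ∀ z ∈ T, (c v z = a ∨ c v z = b) → ∀ y ∈ T, ¬ r z y → c v y ≠ a → c v y ≠ b →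
          c z y = c v z := by
        intro z hz hab y hy hr h3 h4
        have := hG v z y (hne z hz) (hrne _ _ hr) (hne y hy)
        have := hc z hz y hy hr
        grind
      have hd : ∀ x ∈ T, c v x ≠ a → c v x ≠ b → c v x = c v dx := by
        intro x hx h1 h2
        by_cases hr : r x dx
        · have n1 : ¬ r x dy := fun h => hxy (rt _ _ _ rdx (rt _ _ _ (rs _ _ hr)
            (rt _ _ _ h (rs _ _ rdy))))
          have n2 : ¬ r dx dy := fun h => n1 (rt _ _ _ hr h)
          exact (hD x hx dy hdy n1 h1 h2 dya dyb).trans (hD dx hdx dy hdy n2 dxa dxb dya dyb).symm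
        · exact hD x hx dx hdx hr h1 h2 dxa dxb
      have hzz : ∀ z ∈ T, (c v z = a ∨ c v z = b) → ∀ w ∈ T, (c v w = a ∨ c v w = b) →
          c v z = c v w := by
        intro z hz hza w hw hwa
        by_cases hr : r z w
        · have : ∃ y ∈ T, ¬ r z y ∧ c v y ≠ a ∧ c v y ≠ b := by
            by_cases h : r z dx
            · refine ⟨dy, hdy, fun h' => hxy ?_, dya, dyb⟩
              exact rt _ _ _ rdx (rt _ _ _ (rs _ _ h) (rt _ _ _ h' (rs _ _ rdy)))
            · exact ⟨dx, hdx, h, dxa, dxb⟩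
          obtain ⟨y, hy, hry, ya, yb⟩ := this
          have e1 := hZ z hz hza y hy hry ya yb
          have e2 := hZ w hw hwa y hy (fun h => hry (rt _ _ _ hr h)) ya yb
          have e3 := hh z w y hy hr hry
          rw [← e1, ← e2, e3]
        · obtain ⟨x, hx, rx, xa, xb⟩ := hall z hz
          obtain ⟨y, hy, ry, ya, yb⟩ := hall w hw
          have n1 : ¬ r z y := fun h => hr (rt _ _ _ h (rs _ _ ry))
          have n2 : ¬ r w x := fun h => hr (rt _ _ _ rx (rs _ _ h))
          have e1 := hZ z hz hza y hy n1 ya yb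
          have e2 := hZ w hw hwa x hx n2 xa xb
          have e3 := hh w y z hz ry (fun h => hr (rs _ _ h))
          have e4 := hh z x w hw rx hr
          rw [← e1, ← e2, hs z y, ← e3, hs w z, e4, hs]
      by_cases hex : ∃ z ∈ T, c v z = a ∨ c v z = b
      · obtain ⟨z, hz, hza⟩ := hex
        refine ⟨c v z, c v dx, fun x => x = v, ⟨v, by simp⟩,
          ⟨dx, by simp [hdx], (hne dx hdx).symm⟩, ?_⟩
        intro x hx y hy h1 h2
        have hyT : y ∈ T := by simpa [h2] using hy
        have := hzz z hz hza y hyT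
        have := hd y hyT
        grind
      · refine ⟨c v dx, c v dx, fun x => x = v, ⟨v, by simp⟩,
          ⟨dx, by simp [hdx], (hne dx hdx).symm⟩, ?_⟩
        intro x hx y hy h1 h2
        have hyT : y ∈ T := by simpa [h2] using hy
        have := hd y hyT
        grind
    · push Not at hall
      obtain ⟨t, ht, hall⟩ := hall
      refine ⟨a, b, fun x => x ≠ v ∧ r t x, ⟨t, by simp [ht], (hne t ht).symm, r.refl t⟩,
        ⟨v, by simp⟩, ?_⟩
      rintro x hx y hy ⟨h1, h2⟩ h3
      have hxT : x ∈ T := by simpa [h1] using hx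
      by_cases hyv : y = v
      · have := hall x hxT h2
        have := hs x y
        grind
      · have hyT : y ∈ T := by simpa [hyv] using hy
        exact hc x hxT y hyT (fun h => h3 ⟨hyv, rt _ _ _ h2 h⟩)

/-- Number of ordered pairs of distinct vertices of `S` with colour `i`. -/
def cnt {V C : Type*} [DecidableEq V] [DecidableEq C] (c : V → V → C) (S : Finset V) (i : C) : ℕ :=
  (S.offDiag.filter (fun p => c p.1 p.2 = i)).card

theorem four_count {V C : Type*} [DecidableEq V] [DecidableEq C] {c : V → V → C}
    (S W : Finset V) (hW : W ⊆ S) (hW4 : W.card = 4) (r : Setoid V) (a b : C)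
    (hc : ∀ x ∈ S, ∀ y ∈ S, ¬ r x y → (c x y = a ∨ c x y = b))
    (hp : ∀ x ∈ W, ∀ y ∈ W, x ≠ y → ¬ r x y) :
    6 * S.card ≤ 12 + (S.offDiag.filter (fun p => c p.1 p.2 = a ∨ c p.1 p.2 = b)).card := by
  classical
  have h3 : ∀ y ∈ S, 3 ≤ (W.filter (fun w => ¬ r w y)).card := by
    intro y hy
    have h1 := Finset.card_filter_add_card_filter_not (s := W) (fun w => r w y)
    have h2 : (W.filter (fun w => r w y)).card ≤ 1 := by
      rw [Finset.card_le_one]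
      intro u hu w hw
      simp only [Finset.mem_filter] at hu hw
      by_contra hne
      exact hp u hu.1 w hw.1 hne (r.trans hu.2 (r.symm hw.2))
    omega
  let A : Finset (V × V) := S.biUnion (fun y => (W.filter (fun w => ¬ r w y)).image (fun w => (w, y)))
  let B : Finset (V × V) :=
    (S \ W).biUnion (fun y => (W.filter (fun w => ¬ r w y)).image (fun w => (y, w)))
  have hA : S.card * 3 ≤ A.card := by
    rw [Finset.card_biUnion]
    · rw [← smul_eq_mul]
      refine Finset.card_nsmul_le_sum _ _ _ fun y hy => ?_
      rw [Finset.card_image_of_injective _ (fun u w h => by simpa using h)]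
      exact h3 y hy
    · intro x _ y _ hxy
      rw [Function.onFun, Finset.disjoint_left]
      intro p hp hq
      simp only [Finset.mem_image] at hp hq
      grind
  have hB : (S \ W).card * 3 ≤ B.card := by
    rw [Finset.card_biUnion]
    · rw [← smul_eq_mul]
      refine Finset.card_nsmul_le_sum _ _ _ fun y hy => ?_
      rw [Finset.card_image_of_injective _ (fun u w h => by simpa using h)]
      exact h3 y (Finset.mem_sdiff.1 hy).1
    · intro x _ y _ hxy
      rw [Function.onFun, Finset.disjoint_left]
      intro p hp hq
      simp only [Finset.mem_image] at hp hq
      grind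
  have hAB : Disjoint A B := by
    rw [Finset.disjoint_left]
    intro p hp hq
    simp only [A, B, Finset.mem_biUnion, Finset.mem_image, Finset.mem_filter,
      Finset.mem_sdiff] at hp hq
    grind
  have hsub : A ∪ B ⊆ S.offDiag.filter (fun p => c p.1 p.2 = a ∨ c p.1 p.2 = b) := by
    intro p hp
    simp only [A, B, Finset.mem_union, Finset.mem_biUnion, Finset.mem_image, Finset.mem_filter,
      Finset.mem_sdiff] at hp
    simp only [Finset.mem_filter, Finset.mem_offDiag]
    rcases hp with ⟨y, hy, w, ⟨hw, hr⟩, rfl⟩ | ⟨y, ⟨hy, hyW⟩, w, ⟨hw, hr⟩, rfl⟩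
    · exact ⟨⟨hW hw, hy, fun e => hr ((show w = y from e) ▸ r.refl _)⟩, hc w (hW hw) y hy hr⟩
    · exact ⟨⟨hy, hW hw, fun e => hr ((show y = w from e) ▸ r.refl _)⟩,
        hc y hy w (hW hw) (fun h => hr (r.symm h))⟩
  have := Finset.card_le_card hsub
  rw [Finset.card_union_of_disjoint hAB] at this
  have := Finset.card_sdiff_add_card_eq_card hW
  omega

theorem main_dich {V C : Type*} [DecidableEq V] [DecidableEq C] {c : V → V → C}
    (hs : ∀ x y, c x y = c y x) (hG : Gal c) (S : Finset V) (h2 : 2 ≤ S.card) :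
    (∃ X ⊆ S, X.Nonempty ∧ (S \ X).Nonempty ∧ ∃ i, ∀ x ∈ X, ∀ y ∈ S \ X, c x y = i) ∨
    ∃ a b, 6 * S.card ≤ 12 + (S.offDiag.filter (fun p => c p.1 p.2 = a ∨ c p.1 p.2 = b)).card := by
  classical
  obtain ⟨a, b, r, ⟨x, hx, y, hy, hxy⟩, hc, hh⟩ := (hasCut hs hG S h2).part hs hG
  have rr : ∀ x, r x x := fun x => r.refl x
  have rs : ∀ x y, r x y → r y x := fun x y h => r.symm h
  have rt : ∀ x y z, r x y → r y z → r x z := fun x y z h h' => r.trans h h'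
  have hom : ∀ x ∈ S, ∀ y ∈ S, ∀ u ∈ S, ∀ w ∈ S, ¬ r x y → r x u → r y w → c u w = c x y := by
    intro x hx y hy u hu w hw h1 h2 h3
    have e1 := hh x u y hy h2 h1
    have e2 := hh y w u hu h3 (fun h => h1 (rt _ _ _ h2 (rs _ _ h)))
    rw [e1, hs u y, e2, hs]
  -- a class whose colours to the representatives of all other classes agree gives a cut
  have cut : ∀ x ∈ S, (∃ y ∈ S, ¬ r x y) → ∀ i,
      (∀ w ∈ S, ¬ r x w → ∃ y ∈ S, r y w ∧ c x y = i) →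
      (∃ X ⊆ S, X.Nonempty ∧ (S \ X).Nonempty ∧ ∃ i, ∀ x ∈ X, ∀ y ∈ S \ X, c x y = i) := by
    rintro x hx ⟨y, hy, hxy⟩ i hi
    refine ⟨S.filter (fun u => r x u), Finset.filter_subset _ _,
      ⟨x, by simp [hx, rr]⟩, ⟨y, by simp [hy, hxy]⟩, i, ?_⟩
    intro u hu w hw
    simp only [Finset.mem_filter, Finset.mem_sdiff, not_and] at hu hw
    obtain ⟨z, hz, hzw, hi⟩ := hi w hw.1 (hw.2 hw.1)
    rw [← hi]
    exact hom x hx z hz u hu.1 w hw.1 (fun h => hw.2 hw.1 (rt _ _ _ h hzw)) hu.2 hzw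
  by_cases h3 : ∃ z ∈ S, ¬ r x z ∧ ¬ r y z
  · obtain ⟨z, hz, hxz, hyz⟩ := h3
    by_cases h4 : ∃ w ∈ S, ¬ r x w ∧ ¬ r y w ∧ ¬ r z w
    · obtain ⟨w, hw, hxw, hyw, hzw⟩ := h4
      right
      have n : ∀ x y, ¬ r x y → x ≠ y := by rintro x y h rfl; exact h (rr _)
      refine ⟨a, b, four_count S {x, y, z, w} ?_ ?_ r a b hc ?_⟩
      · intro u hu
        simp only [Finset.mem_insert, Finset.mem_singleton] at hu
        grind
      · have := n _ _ hxy
        have := n _ _ hxz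
        have := n _ _ hxw
        have := n _ _ hyz
        have := n _ _ hyw
        have := n _ _ hzw
        rw [Finset.card_eq_of_equiv_fin]
        exact Finset.equivFinOfCardEq (by grind)
      · intro u hu v hv huv
        simp only [Finset.mem_insert, Finset.mem_singleton] at hu hv
        rcases hu with rfl | rfl | rfl | rfl <;> rcases hv with rfl | rfl | rfl | rfl <;>
          first
          | exact absurd rfl huv
          | assumption
          | (intro h; have := rs _ _ h; contradiction)
    · left
      push Not at h4
      have n : ∀ x y, ¬ r x y → x ≠ y := by rintro x y h rfl; exact h (rr _)
      rcases hG x y z (n _ _ hxy) (n _ _ hyz) (n _ _ hxz) with e | e | e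
      · refine cut y hy ⟨z, hz, hyz⟩ (c x y) fun w hw hyw => ?_
        by_cases hxw : r x w
        · exact ⟨x, hx, hxw, hs _ _⟩
        · exact ⟨z, hz, h4 w hw hxw hyw, e.symm⟩
      · refine cut z hz ⟨x, hx, fun h => hxz (rs _ _ h)⟩ (c x z) fun w hw hzw => ?_
        by_cases hxw : r x w
        · exact ⟨x, hx, hxw, hs _ _⟩
        · refine ⟨y, hy, ?_, by rw [hs, e]⟩
          by_contra hyw
          exact hzw (h4 w hw hxw hyw)
      · refine cut x hx ⟨y, hy, hxy⟩ (c x y) fun w hw hxw => ?_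
        by_cases hyw : r y w
        · exact ⟨y, hy, hyw, rfl⟩
        · exact ⟨z, hz, h4 w hw hxw hyw, e.symm⟩
  · left
    push Not at h3
    exact cut x hx ⟨y, hy, hxy⟩ (c x y) fun w hw h => ⟨y, hy, h3 w hw h, rfl⟩

theorem cut_count {V C : Type*} [DecidableEq V] [DecidableEq C] {c : V → V → C}
    (hs : ∀ x y, c x y = c y x) (S X : Finset V) (hX : X ⊆ S) (i : C)
    (h : ∀ x ∈ X, ∀ y ∈ S \ X, c x y = i) :
    2 * (X.card * (S \ X).card) ≤ cnt c S i := by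
  have hd : Disjoint (X ×ˢ (S \ X)) ((S \ X) ×ˢ X) := by
    rw [Finset.disjoint_left]
    intro p hp hq
    simp only [Finset.mem_product, Finset.mem_sdiff] at hp hq
    exact hp.2.2 hq.2
  have hsub : (X ×ˢ (S \ X)) ∪ ((S \ X) ×ˢ X) ⊆ S.offDiag.filter (fun p => c p.1 p.2 = i) := by
    rintro ⟨u, w⟩ hp
    simp only [Finset.mem_union, Finset.mem_product, Finset.mem_filter, Finset.mem_offDiag] at hp ⊢
    rcases hp with ⟨h1, h2⟩ | ⟨h1, h2⟩
    · have h3 := Finset.mem_sdiff.1 h2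
      exact ⟨⟨hX h1, h3.1, by rintro rfl; exact h3.2 h1⟩, h _ h1 _ h2⟩
    · have h3 := Finset.mem_sdiff.1 h1
      exact ⟨⟨h3.1, hX h2, by rintro rfl; exact h3.2 h2⟩, by rw [hs]; exact h _ h2 _ h1⟩
  have := Finset.card_le_card hsub
  rw [Finset.card_union_of_disjoint hd, Finset.card_product, Finset.card_product] at this
  unfold cnt
  nlinarith

theorem pair_count {V C : Type*} [DecidableEq V] [DecidableEq C] (c : V → V → C)
    (S : Finset V) (a b : C) :
    (S.offDiag.filter (fun p => c p.1 p.2 = a ∨ c p.1 p.2 = b)).card ≤ cnt c S a +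
      (if a = b then 0 else cnt c S b) := by
  split_ifs with h
  · subst h; simp [cnt]
  · rw [Finset.filter_or]; exact Finset.card_union_le _ _

theorem cnt_eq (c : Sym2 (Fin 9) → Fin 5) (i : Fin 5) :
    cnt (fun x y => c s(x, y)) Finset.univ i =
      2 * (Finset.univ.filter (fun e : Sym2 (Fin 9) => ¬ e.IsDiag ∧ c e = i)).card := by
  unfold cnt
  rw [Finset.card_eq_sum_card_fiberwise (f := fun p : Fin 9 × Fin 9 => s(p.1, p.2))
    (t := Finset.univ.filter (fun e : Sym2 (Fin 9) => ¬ e.IsDiag ∧ c e = i)),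
    Finset.sum_const_nat (m := 2), mul_comm]
  · intro e he
    induction e using Sym2.ind with
    | _ x y =>
      simp only [Finset.mem_filter, Finset.mem_univ, true_and, Sym2.mk_isDiag_iff] at he
      have : (Finset.filter (fun p : Fin 9 × Fin 9 => s(p.1, p.2) = s(x, y))
          (Finset.filter (fun p : Fin 9 × Fin 9 => c s(p.1, p.2) = i) Finset.univ.offDiag))
          = {(x, y), (y, x)} := by
        ext ⟨u, w⟩
        simp only [Finset.mem_filter, Finset.mem_offDiag, Finset.mem_univ, true_and,
          Finset.mem_insert, Finset.mem_singleton, Prod.mk.injEq, Sym2.eq_iff]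
        constructor
        · exact fun h => h.2
        · intro h
          refine ⟨?_, h⟩
          rcases h with ⟨rfl, rfl⟩ | ⟨rfl, rfl⟩
          · exact he
          · exact ⟨fun h => he.1 h.symm, by rw [Sym2.eq_swap]; exact he.2⟩
      rw [this, Finset.card_pair]
      intro h
      exact he.1 (Prod.mk.inj h).1
  · intro p hp
    simp at hp ⊢
    exact hp

theorem stmt_13 :
    ¬ ∃ c : Sym2 (Fin 9) → Fin 5, IsGallaiColoring c ∧
      Multiset.map
        (fun i => (Finset.univ.filter
          (fun e : Sym2 (Fin 9) => ¬ e.IsDiag ∧ c e = i)).card)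
        (Finset.univ : Finset (Fin 5)).val = {12, 6, 6, 6, 6} := by
  rintro ⟨c, hG, hm⟩
  set g : Fin 5 → ℕ := fun i => (Finset.univ.filter
          (fun e : Sym2 (Fin 9) => ¬ e.IsDiag ∧ c e = i)).card with hg
  set f : Fin 9 → Fin 9 → Fin 5 := fun x y => c s(x, y) with hf
  have hs : ∀ x y, f x y = f y x := fun x y => by simp only [hf, Sym2.eq_swap]
  have hGal : Gal f := hG
  have hcnt : ∀ i, cnt f Finset.univ i = 2 * g i := cnt_eq c
  -- one colour m has 12 edges and the others have 6
  have hval : ∀ i, g i = 12 ∨ g i = 6 := by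
    intro i
    have : g i ∈ Multiset.map g (Finset.univ : Finset (Fin 5)).val :=
      Multiset.mem_map_of_mem _ (Finset.mem_univ i)
    rw [hm] at this
    simpa using this
  have hsum : ∑ i, g i = 36 := by
    change (Multiset.map g (Finset.univ : Finset (Fin 5)).val).sum = 36
    rw [hm]; rfl
  have htwo : ∀ i j, i ≠ j → g i + g j ≤ 18 := by
    intro i j hij
    rw [Fin.sum_univ_five] at hsum
    have h0 := hval 0
    have h1 := hval 1
    have h2 := hval 2
    have h3 := hval 3
    have h4 := hval 4
    fin_cases i <;> fin_cases j <;> simp at hij ⊢ <;> omega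
  rcases main_dich hs hGal Finset.univ (by simp) with ⟨X, hXS, hX1, hX2, i, hi⟩ | ⟨a, b, hab⟩
  · have h1 := cut_count hs Finset.univ X hXS i hi
    rw [hcnt] at h1
    have hcard := Finset.card_sdiff_add_card_eq_card hXS
    have p1 := hX1.card_pos
    have p2 := hX2.card_pos
    simp only [Finset.card_univ, Fintype.card_fin] at hcard
    have hv := hval i
    -- there is a vertex all of whose edges have colour i
    have hvex : ∃ v, ∀ y, y ≠ v → f v y = i := by
      have : X.card = 1 ∨ (Finset.univ \ X).card = 1 := by
        generalize X.card = p at *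
        generalize (Finset.univ \ X).card = q at *
        obtain rfl : q = 9 - p := by omega
        have : p ≤ 8 := by omega
        interval_cases p <;> simp at * <;> omega
      rcases this with h | h
      · obtain ⟨v, rfl⟩ := Finset.card_eq_one.1 h
        exact ⟨v, fun y hy => hi v (by simp) y (by simp [hy])⟩
      · obtain ⟨v, hv⟩ := Finset.card_eq_one.1 h
        refine ⟨v, fun y hy => ?_⟩
        rw [hs]
        refine hi y ?_ v (by simp [hv])
        by_contra hyX
        have : y ∈ Finset.univ \ X := by simp [hyX]
        rw [hv] at this
        simp at this
        exact hy this
    obtain ⟨v, hv'⟩ := hvex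
    have hgi : g i = 12 := by
      have : 8 ≤ X.card * (Finset.univ \ X).card := by
        generalize X.card = p at *
        generalize (Finset.univ \ X).card = q at *
        obtain rfl : q = 9 - p := by omega
        have : p ≤ 8 := by omega
        interval_cases p <;> simp
      omega
    set S : Finset (Fin 9) := Finset.univ.erase v with hS
    have hS8 : S.card = 8 := by simp [hS]
    have hle : ∀ j, cnt f S j ≤ cnt f Finset.univ j := fun j =>
      Finset.card_le_card (Finset.filter_subset_filter _ (Finset.offDiag_mono (Finset.subset_univ _)))
    have hci : cnt f S i + 16 ≤ 24 := by
      have e1 := hcnt i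
      rw [hgi] at e1
      have hd : Disjoint (S.offDiag.filter (fun p => f p.1 p.2 = i)) (({v} ×ˢ S) ∪ (S ×ˢ {v})) := by
        rw [Finset.disjoint_left]
        rintro ⟨u, w⟩ hp hq
        simp [hS] at hp hq
        grind
      have hd2 : Disjoint ({v} ×ˢ S) (S ×ˢ {v}) := by
        rw [Finset.disjoint_left]
        rintro ⟨u, w⟩ hp hq
        simp [hS] at hp hq
        grind
      have hsub : (S.offDiag.filter (fun p => f p.1 p.2 = i)) ∪ (({v} ×ˢ S) ∪ (S ×ˢ {v})) ⊆
          Finset.univ.offDiag.filter (fun p => f p.1 p.2 = i) := by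
        rintro ⟨u, w⟩ hp
        have := hv' u
        have := hv' w
        have := hs u w
        simp only [hS, Finset.mem_union, Finset.mem_filter, Finset.mem_offDiag,
          Finset.mem_product, Finset.mem_singleton, Finset.mem_erase, Finset.mem_univ] at hp ⊢
        grind
      have := Finset.card_le_card hsub
      rw [Finset.card_union_of_disjoint hd, Finset.card_union_of_disjoint hd2,
        Finset.card_product, Finset.card_product, hS8] at this
      simp only [Finset.card_singleton] at this
      unfold cnt at e1 ⊢
      omega
    have hc12 : ∀ j, cnt f S j ≤ 12 := by
      intro j
      by_cases hj : i = j
      · subst hj; omega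
      · have := htwo i j hj
        have := hle j
        rw [hcnt] at this
        omega
    rcases main_dich hs hGal S (by omega) with ⟨Y, hYS, hY1, hY2, k, hk⟩ | ⟨a, b, hab⟩
    · have h1 := cut_count hs S Y hYS k hk
      have h2 := hc12 k
      have hcard := Finset.card_sdiff_add_card_eq_card hYS
      have p1 := hY1.card_pos
      have p2 := hY2.card_pos
      rw [hS8] at hcard
      have : 7 ≤ Y.card * (S \ Y).card := by
        generalize Y.card = p at *
        generalize (S \ Y).card = q at *
        obtain rfl : q = 8 - p := by omega
        have : p ≤ 7 := by omega
        interval_cases p <;> simp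
      omega
    · have h1 := pair_count f S a b
      have h2 := hc12 a
      have h3 := hc12 b
      split_ifs at h1 <;> omega
  · have h1 := pair_count f Finset.univ a b
    simp only [Finset.card_univ, Fintype.card_fin] at hab
    rw [hcnt, hcnt] at h1
    split_ifs at h1 with h
    · have := hval a
      omega
    · have := htwo a b h
      omega
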